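/- Let Y = (y_1,…,y_p) be a word of positive integers and let x ≤ y < z be positive integers. Let col(x), col(y), col(z) be the column indices of the boxes added when x, y, z are inserted during the computation of RSK_1(Y z x y), and let col'(x), col'(y), col'(z) be the corresponding column indices during the computation of RSK_1(Y x z y). Then: (1) if col(x) < col(z) < col(y), then col'(y) < col'(x) < col'(z); and (2) if col(x) < col(y) < col(z), then col'(x) < col'(y) < col'(z). -/

import Mathlib

/-- RSK row insertion of a letter into a row: the letter bumps the leftmost
entry strictly greater than it (or is appended at the end of the row). -/
def insertRow : List ℕ → ℕ → List ℕ × Option ℕ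
  | [], x => ([x], none)
  | y :: ys, x =>
    if y ≤ x then
      let p := insertRow ys x
      (y :: p.1, p.2)
    else (x :: ys, some y)

/-- RSK row insertion of a letter into a tableau (a list of rows). -/
def insertTab : List (List ℕ) → ℕ → List (List ℕ)
  | [], x => [[x]]
  | row :: rest, x =>
    match insertRow row x with
    | (row', none) => row' :: rest
    | (row', some y) => row' :: insertTab rest y

/-- The (1-indexed) column index of the box added to the shape when a letter
is row-inserted into a tableau. -/
def insertCol : List (List ℕ) → ℕ → ℕ
  | [], _ => 1
  | row :: rest, x =>
    match insertRow row x with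
    | (row', none) => row'.length
    | (_, some y) => insertCol rest y

/-- The (1-indexed) row index of the box added to the shape when a letter
is row-inserted into a tableau. -/
def insertRowIdx : List (List ℕ) → ℕ → ℕ
  | [], _ => 1
  | row :: rest, x =>
    match insertRow row x with
    | (_, none) => 1
    | (_, some y) => insertRowIdx rest y + 1

/-- The RSK insertion tableau of a word: insert its letters in order into
the empty tableau. -/
def RSK1 (w : List ℕ) : List (List ℕ) := w.foldl insertTab []

theorem insertTab_cons (R : List ℕ) (rest : List (List ℕ)) (x : ℕ) :
    insertTab (R :: rest) x = (insertRow R x).1 ::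
      (match (insertRow R x).2 with | none => rest | some y => insertTab rest y) := by
  rw [insertTab]
  rcases h : insertRow R x with ⟨R', _ | a⟩ <;> simp

theorem insertCol_cons (R : List ℕ) (rest : List (List ℕ)) (x : ℕ) :
    insertCol (R :: rest) x =
      (match (insertRow R x).2 with
        | none => (insertRow R x).1.length | some y => insertCol rest y) := by
  rw [insertCol]
  rcases h : insertRow R x with ⟨R', _ | a⟩ <;> simp

theorem insertRow_nil (x : ℕ) : insertRow [] x = ([x], none) := rfl

theorem insertRow_le {r x : ℕ} (R : List ℕ) (h : r ≤ x) :
    insertRow (r :: R) x = (r :: (insertRow R x).1, (insertRow R x).2) := by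
  simp [insertRow, h]

theorem insertRow_gt {r x : ℕ} (R : List ℕ) (h : x < r) :
    insertRow (r :: R) x = (x :: R, some r) := by
  simp [insertRow, h]

def Srt : List ℕ → Prop
  | [] => True
  | r :: R => (∀ s ∈ R, r ≤ s) ∧ Srt R

def Dom : List ℕ → List ℕ → Prop
  | _, [] => True
  | [], _ :: _ => False
  | r :: R, s :: S => r < s ∧ Dom R S

def Valid : List (List ℕ) → Prop
  | [] => True
  | R :: rest => Srt R ∧ Dom R (rest.headD []) ∧ Valid rest

theorem len_none (R : List ℕ) (x : ℕ) (h : (insertRow R x).2 = none) :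
    (insertRow R x).1.length = R.length + 1 := by
  induction R with
  | nil => simp [insertRow]
  | cons r R ih =>
    by_cases hr : r ≤ x
    · rw [insertRow_le R hr] at h ⊢; simp [ih h]
    · rw [insertRow_gt R (by omega)] at h; simp at h

theorem len_some (R : List ℕ) (x a : ℕ) (h : (insertRow R x).2 = some a) :
    (insertRow R x).1.length = R.length := by
  induction R with
  | nil => simp [insertRow] at h
  | cons r R ih =>
    by_cases hr : r ≤ x
    · rw [insertRow_le R hr] at h ⊢; simp [ih h]
    · rw [insertRow_gt R (by omega)]; simp

theorem mem_ins (R : List ℕ) (x s : ℕ) (h : s ∈ (insertRow R x).1) : s = x ∨ s ∈ R := by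
  induction R with
  | nil => simpa [insertRow] using h
  | cons r R ih =>
    by_cases hr : r ≤ x
    · rw [insertRow_le R hr] at h; grind
    · rw [insertRow_gt R (by omega)] at h; grind

theorem mem_bump (R : List ℕ) (x a : ℕ) (h : (insertRow R x).2 = some a) : a ∈ R ∧ x < a := by
  induction R with
  | nil => simp [insertRow] at h
  | cons r R ih =>
    by_cases hr : r ≤ x
    · rw [insertRow_le R hr] at h; grind
    · rw [insertRow_gt R (by omega)] at h; grind

theorem srt_ins (R : List ℕ) (x : ℕ) (h : Srt R) : Srt (insertRow R x).1 := by
  induction R with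
  | nil => simp [insertRow, Srt]
  | cons r R ih =>
    obtain ⟨h1, h2⟩ := h
    by_cases hr : r ≤ x
    · rw [insertRow_le R hr]
      refine ⟨fun s hs => ?_, ih h2⟩
      rcases mem_ins R x s hs with h | h
      · omega
      · exact h1 s h
    · rw [insertRow_gt R (by omega)]
      refine ⟨fun s hs => ?_, h2⟩
      have := h1 s hs
      omega

theorem dom_nil (R : List ℕ) : Dom R [] := by cases R <;> trivial

/-- inserting into the upper row preserves domination -/
theorem dom_mono (R S : List ℕ) (x : ℕ) (h : Dom R S) : Dom (insertRow R x).1 S := by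
  induction R generalizing S with
  | nil => cases S with
    | nil => exact dom_nil _
    | cons s S => exact h.elim
  | cons r R ih => cases S with
    | nil => exact dom_nil _
    | cons s S =>
      obtain ⟨h1, h2⟩ := h
      by_cases hr : r ≤ x
      · rw [insertRow_le R hr]; exact ⟨h1, ih S h2⟩
      · rw [insertRow_gt R (by omega)]; exact ⟨by omega, h2⟩

theorem dom_len (R S : List ℕ) (h : Dom R S) : S.length ≤ R.length := by
  induction R generalizing S with
  | nil => cases S with
    | nil => simp
    | cons s S => exact h.elim
  | cons r R ih => cases S with
    | nil => simp
    | cons s S => simpa using ih S h.2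

theorem dom_bump (R S : List ℕ) (x a : ℕ) (h : Dom R S) (hR : Srt R)
    (ha : (insertRow R x).2 = some a) : Dom (insertRow R x).1 (insertRow S a).1 := by
  induction R generalizing S with
  | nil => simp [insertRow] at ha
  | cons r R ih =>
    have hm := mem_bump _ _ _ ha
    by_cases hr : r ≤ x
    · rw [insertRow_le R hr] at ha ⊢
      cases S with
      | nil => exact ⟨by omega, dom_nil _⟩
      | cons s S =>
        by_cases hs : s ≤ a
        · rw [insertRow_le S hs]; exact ⟨h.1, ih S h.2 hR.2 ha⟩
        · rw [insertRow_gt S (by omega)]; exact ⟨by omega, dom_mono _ _ _ h.2⟩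
    · rw [insertRow_gt R (by omega)] at ha ⊢
      simp at ha
      subst ha
      cases S with
      | nil => exact ⟨by omega, dom_nil _⟩
      | cons s S =>
        rw [insertRow_gt S h.1]; exact ⟨by omega, h.2⟩

theorem headD_insertTab (T : List (List ℕ)) (a : ℕ) :
    (insertTab T a).headD [] = (insertRow (T.headD []) a).1 := by
  cases T with
  | nil => simp [insertTab, insertRow]
  | cons R rest => simp [insertTab_cons]

theorem valid_ins (T : List (List ℕ)) (x : ℕ) (h : Valid T) : Valid (insertTab T x) := by
  induction T generalizing x with
  | nil => simp [insertTab, Valid, Srt, dom_nil]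
  | cons R rest ih =>
    obtain ⟨h1, h2, h3⟩ := h
    rw [insertTab_cons]
    refine ⟨srt_ins _ _ h1, ?_, ?_⟩
    · cases ha : (insertRow R x).2 with
      | none => exact dom_mono _ _ _ h2
      | some a => simp only [headD_insertTab]; exact dom_bump _ _ _ _ h2 h1 ha
    · cases ha : (insertRow R x).2 with
      | none => exact h3
      | some a => exact ih a h3

theorem col_le (T : List (List ℕ)) (R : List ℕ) (x a : ℕ) (h : Valid (R :: T))
    (ha : (insertRow R x).2 = some a) : insertCol T a ≤ R.length := by
  induction T generalizing R x a with
  | nil =>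
    have := len_some _ _ _ ha
    have h2 := (mem_bump _ _ _ ha).1
    have := List.length_pos_of_mem h2
    simp only [insertCol]; omega
  | cons S rest ih =>
    have hd := dom_len _ _ (dom_bump R S x a h.2.1 h.1 ha)
    have hl := len_some _ _ _ ha
    have hd2 : S.length ≤ R.length := dom_len _ _ h.2.1
    rw [insertCol_cons]
    cases hb : (insertRow S a).2 with
    | none => simp only; omega
    | some b => have := ih S a b h.2.2 hb; simp only; omega

theorem row_yz (R : List ℕ) (y z : ℕ) (hyz : y < z) :
    ∃ b, (insertRow (insertRow R z).1 y).2 = some b ∧ b ≤ z ∧ (b = z ∨ b ∈ R) := by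
  induction R with
  | nil => exact ⟨z, by simp [insertRow, Nat.not_le.mpr hyz], le_rfl, Or.inl rfl⟩
  | cons r R ih =>
    by_cases hr : r ≤ z
    · rw [insertRow_le R hr]
      by_cases hy : r ≤ y
      · simp only [insertRow_le _ hy]; grind
      · simp only [insertRow_gt _ (show y < r by omega)]; grind
    · rw [insertRow_gt R (by omega)]
      simp only [insertRow_gt _ hyz]; grind

theorem row1 (R : List ℕ) (x y z : ℕ) (hR : Srt R) (hxy : x ≤ y) (hyz : y < z) :
    (∃ a b, (insertRow (insertRow R z).1 x).2 = some a ∧ (insertRow R x).2 = some a ∧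
      (insertRow (insertRow (insertRow R z).1 x).1 y).2 = some b ∧
      (insertRow (insertRow (insertRow R x).1 z).1 y).2 = some b ∧
      (insertRow (insertRow R x).1 z).2 = (insertRow R z).2 ∧ a ≤ b ∧ b ≤ z) ∨
    ((insertRow (insertRow R z).1 x).2 = some z ∧
      (insertRow (insertRow (insertRow R x).1 z).1 y).2 = some z ∧
      (insertRow R x).2 = (insertRow R z).2 ∧
      (insertRow (insertRow R x).1 z).2 = (insertRow (insertRow (insertRow R z).1 x).1 y).2 ∧
      ((insertRow R z).2 = none → (insertRow (insertRow R x).1 z).2 = none) ∧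
      (∀ c d, (insertRow R z).2 = some c → (insertRow (insertRow R x).1 z).2 = some d →
        c ≤ d)) := by
  induction R with
  | nil =>
    right
    have : ¬ z ≤ x := by omega
    have : ¬ z ≤ y := by omega
    have : x ≤ z := by omega
    simp [insertRow, *]
  | cons r R ih =>
    obtain ⟨h1, h2⟩ := hR
    by_cases hr : r ≤ x
    · simp only [insertRow_le _ hr, insertRow_le _ (show r ≤ y by omega),
        insertRow_le _ (show r ≤ z by omega)]
      exact ih h2
    by_cases hz : r ≤ z
    · left
      simp only [insertRow_le _ hz, insertRow_gt _ (show x < r by omega), insertRow_le _ hxy,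
        insertRow_le _ (show x ≤ z by omega)]
      obtain ⟨b, hb, hbz, hb'⟩ := row_yz R y z hyz
      refine ⟨r, b, by trivial, by trivial, hb, hb, by trivial, ?_, hbz⟩
      rcases hb' with h | h
      · omega
      · exact h1 b h
    · right
      simp only [insertRow_gt _ (show z < r by omega), insertRow_gt _ (show x < z by omega),
        insertRow_gt _ (show x < r by omega), insertRow_le _ hxy,
        insertRow_le _ (show x ≤ z by omega)]
      cases R with
      | nil => simp [insertRow, Nat.not_le.mpr hyz]
      | cons s R =>
        have hs : r ≤ s := h1 s (by simp)
        simp only [insertRow_gt _ (show z < s by omega), insertRow_gt _ (show y < s by omega),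
          insertRow_gt _ hyz]
        grind

theorem row2 (R : List ℕ) (x y z : ℕ) (hR : Srt R) (hxy : x < y) (hyz : y ≤ z) :
    ∃ a, (insertRow (insertRow R y).1 x).2 = some a ∧
      (insertRow (insertRow (insertRow R y).1 z).1 x).2 = some a ∧
      (insertRow (insertRow (insertRow R y).1 x).1 z).2 = (insertRow (insertRow R y).1 z).2 ∧
      a ≤ y ∧ ((insertRow R y).2 = none → (insertRow (insertRow R y).1 z).2 = none) ∧
      (∀ b c, (insertRow R y).2 = some b → (insertRow (insertRow R y).1 z).2 = some c →
        b ≤ c) := by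
  induction R with
  | nil =>
    have : ¬ y ≤ x := by omega
    have : x ≤ z := by omega
    simp [insertRow, *]
  | cons r R ih =>
    obtain ⟨h1, h2⟩ := hR
    by_cases hr : r ≤ x
    · simp only [insertRow_le _ hr, insertRow_le _ (show r ≤ y by omega),
        insertRow_le _ (show r ≤ z by omega)]
      exact ih h2
    by_cases hy : r ≤ y
    · obtain ⟨a, -, -, -, -, h5, h6⟩ := ih h2
      simp only [insertRow_le _ hy, insertRow_le _ (show r ≤ z by omega),
        insertRow_gt _ (show x < r by omega), insertRow_le _ (show x ≤ z by omega)]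
      exact ⟨r, by trivial, by trivial, by trivial, hy, h5, h6⟩
    · simp only [insertRow_gt _ (show y < r by omega), insertRow_le _ hyz,
        insertRow_gt _ hxy, insertRow_le _ (show x ≤ z by omega)]
      refine ⟨y, by trivial, by trivial, by trivial, le_rfl, by simp, fun b c hb hc => ?_⟩
      have := h1 c (mem_bump _ _ _ hc).1
      grind

theorem knuth2 (T : List (List ℕ)) (x y z : ℕ) (hT : Valid T) (hxy : x < y) (hyz : y ≤ z) :
    insertCol T y < insertCol (insertTab (insertTab T y) x) z ∧
    insertCol (insertTab T y) z = insertCol (insertTab (insertTab T y) x) z ∧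
    insertCol (insertTab (insertTab T y) z) x = insertCol (insertTab T y) x := by
  induction T generalizing x y z with
  | nil =>
    have : ¬ y ≤ x := by omega
    have : x ≤ z := by omega
    simp [insertTab, insertCol, insertRow, *]
  | cons R rest ih =>
    have hT' := valid_ins _ y hT
    obtain ⟨a, e1, e2, e3, hay, h5, h6⟩ := row2 R x y z hT.1 hxy hyz
    have l1 := len_some _ _ _ e1
    cases hb : (insertRow R y).2 with
    | none =>
      have hc := h5 hb
      have l2 := len_none _ _ hc
      have l3 := len_none _ _ (e3.trans hc)
      simp only [insertTab_cons, insertCol_cons, e1, e2, e3, hb, hc]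
      refine ⟨?_, ?_, ?_⟩ <;> first | trivial | omega
    | some b =>
      have l0 := len_some _ _ _ hb
      have cb := col_le _ _ _ _ hT hb
      have hyb := (mem_bump _ _ _ hb).2
      cases hc : (insertRow (insertRow R y).1 z).2 with
      | none =>
        have l2 := len_none _ _ hc
        have l3 := len_none _ _ (e3.trans hc)
        simp only [insertTab_cons, insertCol_cons, e1, e2, e3, hb, hc]
        refine ⟨?_, ?_, ?_⟩ <;> first | trivial | omega
      | some c =>
        simp only [insertTab_cons, insertCol_cons, e1, e2, e3, hb, hc]
        exact ih a b c hT.2.2 (by omega) (h6 b c hb hc)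

theorem knuth1 (T : List (List ℕ)) (x y z : ℕ) (hT : Valid T) (hxy : x ≤ y) (hyz : y < z) :
    (insertCol T z < insertCol (insertTab (insertTab T z) x) y ∧
      insertCol T x = insertCol T z ∧
      insertCol (insertTab T x) z = insertCol (insertTab (insertTab T z) x) y ∧
      insertCol (insertTab (insertTab T x) z) y = insertCol (insertTab T z) x) ∨
    (insertCol (insertTab (insertTab T z) x) y ≤ insertCol T z ∧
      insertCol T x = insertCol (insertTab T z) x ∧
      insertCol (insertTab T x) z = insertCol T z ∧
      insertCol (insertTab (insertTab T x) z) y = insertCol (insertTab (insertTab T z) x) y) := by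
  induction T generalizing x y z with
  | nil =>
    have : ¬ z ≤ x := by omega
    have : ¬ z ≤ y := by omega
    have : x ≤ z := by omega
    simp [insertTab, insertCol, insertRow, *]
  | cons R rest ih =>
    have hT1 := valid_ins _ z hT
    have hT2 := valid_ins _ x hT1
    rcases row1 R x y z hT.1 hxy hyz with ⟨a, b, e1, e2, e3, e4, e5, hab, hbz⟩ |
      ⟨e1, e2, e3, e4, h5, h6⟩
    · have l1 := len_some _ _ _ e1
      have l2 := len_some _ _ _ e2
      cases hc : (insertRow R z).2 with
      | none =>
        right
        have l3 := len_none _ _ hc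
        have l4 := len_none _ _ (e5.trans hc)
        simp only [insertTab_cons, hc, e1] at hT2
        have := col_le _ _ _ _ hT2 e3
        simp only [insertTab_cons, insertCol_cons, e1, e2, e3, e4, e5, hc]
        refine ⟨?_, ?_, ?_, ?_⟩ <;> first | trivial | omega
      | some c =>
        have := (mem_bump _ _ _ hc).2
        simp only [insertTab_cons, insertCol_cons, e1, e2, e3, e4, e5, hc]
        exact ih a b c hT.2.2 hab (by omega)
    · left
      have l1 := len_some _ _ _ e1
      cases hc : (insertRow R z).2 with
      | none =>
        have hd := h5 hc
        have l2 := len_none _ _ hc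
        have l3 := len_none _ _ (e3.trans hc)
        have l4 := len_none _ _ hd
        have l5 := len_none _ _ (e4.symm.trans hd)
        rw [hc] at e3
        rw [hd] at e4
        simp only [insertTab_cons, insertCol_cons, e1, e2, e3, ← e4, hd, hc]
        refine ⟨?_, ?_, ?_, ?_⟩ <;> first | trivial | omega
      | some c =>
        have l2 := len_some _ _ _ hc
        have l3 := len_some _ _ _ (e3.trans hc)
        have hzc := (mem_bump _ _ _ hc).2
        have cc := col_le _ _ _ _ hT hc
        rw [hc] at e3
        cases hd : (insertRow (insertRow R x).1 z).2 with
        | none =>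
          have l4 := len_none _ _ hd
          have l5 := len_none _ _ (e4.symm.trans hd)
          rw [hd] at e4
          simp only [insertTab_cons, insertCol_cons, e1, e2, e3, ← e4, hd, hc]
          refine ⟨?_, ?_, ?_, ?_⟩ <;> first | trivial | omega
        | some d =>
          rw [hd] at e4
          simp only [insertTab_cons, insertCol_cons, e1, e2, e3, ← e4, hd, hc]
          have := knuth2 rest z c d hT.2.2 hzc (h6 c d hc hd)
          exact ⟨this.1, by trivial, this.2.1, this.2.2⟩

theorem valid_foldl (w : List ℕ) (T : List (List ℕ)) (h : Valid T) :
    Valid (w.foldl insertTab T) := by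
  induction w generalizing T with
  | nil => exact h
  | cons a w ih => exact ih _ (valid_ins _ _ h)

/-- **Lemma (local moves).** Let `x ≤ y < z`.  Write `col(x), col(y), col(z)`
for the columns of the boxes added when inserting `x, y, z` in the
computation of `RSK₁(Y z x y)`, and `col'(x), col'(y), col'(z)` for those in
the computation of `RSK₁(Y x z y)`.  Then
(1) `col(x) < col(z) < col(y)` implies `col'(y) < col'(x) < col'(z)`, and
(2) `col(x) < col(y) < col(z)` implies `col'(x) < col'(y) < col'(z)`. -/
theorem stmt16 (Y : List ℕ) (hY : ∀ w ∈ Y, 0 < w) (x y z : ℕ)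
    (hx : 0 < x) (hxy : x ≤ y) (hyz : y < z) :
    ((insertCol (RSK1 (Y ++ [z])) x < insertCol (RSK1 Y) z ∧
      insertCol (RSK1 Y) z < insertCol (RSK1 (Y ++ [z, x])) y) →
      (insertCol (RSK1 (Y ++ [x, z])) y < insertCol (RSK1 Y) x ∧
       insertCol (RSK1 Y) x < insertCol (RSK1 (Y ++ [x])) z)) ∧
    ((insertCol (RSK1 (Y ++ [z])) x < insertCol (RSK1 (Y ++ [z, x])) y ∧
      insertCol (RSK1 (Y ++ [z, x])) y < insertCol (RSK1 Y) z) →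
      (insertCol (RSK1 Y) x < insertCol (RSK1 (Y ++ [x, z])) y ∧
       insertCol (RSK1 (Y ++ [x, z])) y < insertCol (RSK1 (Y ++ [x])) z)) := by
  have hV : Valid (RSK1 Y) := valid_foldl Y [] trivial
  have e1 : ∀ a, RSK1 (Y ++ [a]) = insertTab (RSK1 Y) a := by
    intro a; simp [RSK1]
  have e2 : ∀ a b, RSK1 (Y ++ [a, b]) = insertTab (insertTab (RSK1 Y) a) b := by
    intro a b; simp [RSK1]
  rw [e1, e1, e2, e2]
  have := knuth1 (RSK1 Y) x y z hV hxy hyz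
  omega
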